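/- Let γ be the standard Gaussian on ℝⁿ, let K ⊆ ℝⁿ with y ↦ sup_{t∈K}⟨y,t⟩ γ-integrable, and let Z(x) = sup_{t∈K}[⟨x,t⟩ − |t|²/2]. For any probability measure ν ≪ γ with finite relative entropy, and any measurable g : ℝⁿ → ℝⁿ with g(x) ∈ closure(K) pointwise, one has ∫ [⟨x, g(x)⟩ − |g(x)|²/2] dν(x) ≤ D_KL(ν||γ) + ∫ sup_{t∈K} ⟨x, t⟩ dγ(x). -/

import Mathlib

open MeasureTheory Real
open scoped RealInnerProductSpace ENNReal

noncomputable def stdGaussian (n : ℕ) : Measure (EuclideanSpace ℝ (Fin n)) :=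
  (volume : Measure (EuclideanSpace ℝ (Fin n))).withDensity
    fun x => ENNReal.ofReal ((2 * π) ^ (-(n : ℝ) / 2) * Real.exp (-‖x‖ ^ 2 / 2))

noncomputable def lap {n : ℕ} (f : EuclideanSpace ℝ (Fin n) → ℝ)
    (x : EuclideanSpace ℝ (Fin n)) : ℝ :=
  ∑ i, fderiv ℝ (fun y => gradient f y) x (EuclideanSpace.single i 1) i

/-- `y ↦ sup_{t ∈ K} ⟨y, t⟩`. -/
noncomputable def gaussWidthFn {n : ℕ} (K : Set (EuclideanSpace ℝ (Fin n)))
    (y : EuclideanSpace ℝ (Fin n)) : ℝ :=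
  ⨆ t : K, ⟪y, (t : EuclideanSpace ℝ (Fin n))⟫

def IsCoupling {n : ℕ}
    (p : Measure (EuclideanSpace ℝ (Fin n) × EuclideanSpace ℝ (Fin n)))
    (ν γ : Measure (EuclideanSpace ℝ (Fin n))) : Prop :=
  p.map Prod.fst = ν ∧ p.map Prod.snd = γ

/-- Squared quadratic Wasserstein distance. -/
noncomputable def W2sq {n : ℕ} (ν γ : Measure (EuclideanSpace ℝ (Fin n))) : ℝ :=
  sInf {r : ℝ | ∃ p, IsCoupling p ν γ ∧ IsProbabilityMeasure p ∧
    r = ∫ q, ‖q.1 - q.2‖ ^ 2 ∂p}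

/-- Monotone transport of a density `φ` of mass at most one, with primitive `Φ`, onto the
normalised restriction of a positive continuous density `w` to `[-M, M]`. -/
lemma exists_transport {w Φ φ : ℝ → ℝ} (hw : Continuous w) (hwpos : ∀ x, 0 < w x)
    (hΦ : ∀ y, HasDerivAt Φ (φ y) y) (hΦ0 : ∀ y, 0 ≤ Φ y) (hΦ1 : ∀ y, Φ y ≤ 1)
    {M : ℝ} (hM : 0 < M) :
    ∃ T : ℝ → ℝ, (∀ y, |T y| ≤ M) ∧
      ∀ y, HasDerivAt T ((∫ x in (-M)..M, w x) * φ y / w (T y)) y := by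
  set v : ℝ → ℝ := fun x => w (max (-M) (min M x)) with hv
  have hvc : Continuous v := by fun_prop
  have hvw : ∀ x ∈ Set.Icc (-M) M, v x = w x := fun x hx => by
    simp [hv, min_eq_right hx.2, max_eq_right hx.1]
  set G : ℝ → ℝ := fun x => ∫ t in (-M)..x, v t with hG
  have hGd : ∀ x, HasDerivAt G (v x) x := fun x =>
    intervalIntegral.integral_hasDerivAt_right (hvc.intervalIntegrable _ _)
      hvc.aestronglyMeasurable.stronglyMeasurableAtFilter hvc.continuousAt
  have hGm : StrictMono G := strictMono_of_deriv_pos fun x => by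
    rw [(hGd x).deriv]; exact hwpos _
  have hGc : Continuous G := continuous_iff_continuousAt.2 fun x => (hGd x).continuousAt
  obtain ⟨x₀, -, hx₀⟩ := (isCompact_Icc (a := -M) (b := M)).exists_isMinOn
    ⟨M, by constructor <;> linarith⟩ hw.continuousOn
  have hlb : ∀ x, w x₀ ≤ v x := fun x =>
    hx₀ ⟨le_max_left _ _, max_le (by linarith) (min_le_left _ _)⟩
  have hmono : Monotone fun x => G x - w x₀ * x := by
    have hd : ∀ x, HasDerivAt (fun x => G x - w x₀ * x) (v x - w x₀ * 1) x := fun x =>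
      (hGd x).sub ((hasDerivAt_id x).const_mul _)
    refine monotone_of_deriv_nonneg (fun x => (hd x).differentiableAt) fun x => ?_
    rw [(hd x).deriv]; linarith [hlb x]
  have hGs : Function.Surjective G := by
    refine hGc.surjective ?_ ?_
    · refine Filter.tendsto_atTop_mono' _ (f₁ := fun x => w x₀ * x + G 0) ?_ ?_
      · filter_upwards [Filter.eventually_ge_atTop 0] with x hx
        have := hmono hx
        simp only [mul_zero, sub_zero] at this
        linarith
      · exact Filter.tendsto_atTop_add_const_right _ _
          (Filter.tendsto_id.const_mul_atTop (hwpos _))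
    · refine Filter.tendsto_atBot_mono' _ (f₁ := fun x => w x₀ * x + G 0) ?_ ?_
      · filter_upwards [Filter.eventually_le_atBot 0] with x hx
        have := hmono hx
        simp only [mul_zero, sub_zero] at this
        linarith
      · exact Filter.tendsto_atBot_add_const_right _ _
          (Filter.tendsto_id.const_mul_atBot (hwpos _))
  set e := hGm.orderIsoOfSurjective G hGs with he
  have hGe : ∀ y, G (e.symm y) = y := fun y => e.apply_symm_apply y
  set m := ∫ x in (-M)..M, w x with hm
  have hGM : G M = m := intervalIntegral.integral_congr fun x hx => by
    rw [Set.uIcc_of_le (by linarith)] at hx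
    exact hvw x hx
  have hGM' : G (-M) = 0 := by simp [hG]
  have hm0 : 0 ≤ m := by
    rw [← hGM, ← hGM']; exact hGm.monotone (by linarith)
  have hT : ∀ y, e.symm (m * Φ y) ∈ Set.Icc (-M) M := fun y => by
    constructor
    · rw [← hGm.le_iff_le, hGe, hGM']; exact mul_nonneg hm0 (hΦ0 y)
    · rw [← hGm.le_iff_le, hGe, hGM]; exact mul_le_of_le_one_right hm0 (hΦ1 y)
  refine ⟨fun y => e.symm (m * Φ y), fun y => abs_le.2 (hT y), fun y => ?_⟩
  have hinv : HasDerivAt e.symm (v (e.symm (m * Φ y)))⁻¹ (m * Φ y) :=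
    HasDerivAt.of_local_left_inverse e.symm.continuous.continuousAt (hGd _) (hwpos _).ne'
      (Filter.Eventually.of_forall hGe)
  have := hinv.comp y ((hΦ y).const_mul m)
  rw [hvw _ (hT y)] at this
  rw [div_eq_inv_mul]
  exact this

lemma gaussianPDFReal_zero_one (x : ℝ) :
    ProbabilityTheory.gaussianPDFReal 0 1 x = (√(2 * π))⁻¹ * Real.exp (-x ^ 2 / 2) := by
  simp [ProbabilityTheory.gaussianPDFReal]

lemma hasDerivAt_gaussianPDFReal (x : ℝ) :
    HasDerivAt (ProbabilityTheory.gaussianPDFReal 0 1)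
      (-x * ProbabilityTheory.gaussianPDFReal 0 1 x) x := by
  have h : HasDerivAt (fun x : ℝ => (√(2 * π))⁻¹ * Real.exp (-x ^ 2 / 2))
      ((√(2 * π))⁻¹ * (Real.exp (-x ^ 2 / 2) * (-(2 * x) / 2))) x := by
    have := ((((hasDerivAt_pow 2 x).neg.div_const 2).exp).const_mul (√(2 * π))⁻¹)
    simpa using this
  rw [show ProbabilityTheory.gaussianPDFReal 0 1 = _ from funext gaussianPDFReal_zero_one]
  convert h using 1
  ring

lemma continuous_gaussianPDFReal : Continuous (ProbabilityTheory.gaussianPDFReal 0 1) :=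
  continuous_iff_continuousAt.2 fun x => (hasDerivAt_gaussianPDFReal x).continuousAt

lemma exists_primitive_gaussianPDFReal :
    ∃ Φ : ℝ → ℝ, (∀ y, HasDerivAt Φ (ProbabilityTheory.gaussianPDFReal 0 1 y) y) ∧
      (∀ y, 0 ≤ Φ y) ∧ ∀ y, Φ y ≤ 1 := by
  set φ := ProbabilityTheory.gaussianPDFReal 0 1 with hφ
  have hint : Integrable φ := ProbabilityTheory.integrable_gaussianPDFReal 0 1
  have hc : Continuous φ := continuous_gaussianPDFReal
  have hpos : ∀ x, 0 ≤ φ x := ProbabilityTheory.gaussianPDFReal_nonneg 0 1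
  refine ⟨fun y => ∫ x in Set.Iic y, φ x, fun y => ?_, fun y => integral_nonneg hpos, fun y => ?_⟩
  · have h : (fun y => ∫ x in Set.Iic y, φ x) =
        fun y => (∫ x in Set.Iic 0, φ x) + ∫ x in (0 : ℝ)..y, φ x := by
      ext y
      rw [← intervalIntegral.integral_Iic_sub_Iic hint.integrableOn hint.integrableOn]
      ring
    rw [h]
    exact (intervalIntegral.integral_hasDerivAt_right (hc.intervalIntegrable _ _)
      hc.aestronglyMeasurable.stronglyMeasurableAtFilter hc.continuousAt).const_add _
  · rw [← ProbabilityTheory.integral_gaussianPDFReal_eq_one 0 one_ne_zero]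
    exact setIntegral_le_integral hint (Filter.Eventually.of_forall hpos)

lemma tendsto_const_add_abs_mul_gaussianPDFReal (M : ℝ) :
    Filter.Tendsto (fun R => 2 * ((M + R) * ProbabilityTheory.gaussianPDFReal 0 1 R))
      Filter.atTop (nhds 0) := by
  have h1 : Filter.Tendsto (fun R : ℝ => Real.exp (-(1 / 2) * R ^ 2)) Filter.atTop (nhds 0) := by
    simpa using tendsto_rpow_abs_mul_exp_neg_mul_sq_cocompact (a := 1 / 2) (by norm_num) 0 |>.mono_left
      atTop_le_cocompact
  have h2 : Filter.Tendsto (fun R : ℝ => |R| * Real.exp (-(1 / 2) * R ^ 2)) Filter.atTop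
      (nhds 0) := by
    simpa using tendsto_rpow_abs_mul_exp_neg_mul_sq_cocompact (a := 1 / 2) (by norm_num) 1 |>.mono_left
      atTop_le_cocompact
  have h3 := ((h1.const_mul M).add h2).const_mul (2 * (√(2 * π))⁻¹)
  simp only [mul_zero, add_zero] at h3
  refine h3.congr' ?_
  filter_upwards [Filter.eventually_ge_atTop 0] with R hR
  rw [gaussianPDFReal_zero_one, abs_of_nonneg hR,
    show -(1 / 2) * R ^ 2 = -R ^ 2 / 2 by ring]
  ring

/-- Infimal convolution inequality for the one-dimensional Gaussian, truncated to `[-M, M]`. -/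
lemma log_integral_exp_le_of_le_add_sq {a f : ℝ → ℝ} (ha : Continuous a)
    (hf : Integrable (fun x => f x * ProbabilityTheory.gaussianPDFReal 0 1 x))
    (haf : ∀ x y, a x ≤ f y + (x - y) ^ 2 / 2) {M : ℝ} (hM : 0 < M) :
    Real.log (∫ x in (-M)..M, Real.exp (a x) * ProbabilityTheory.gaussianPDFReal 0 1 x) ≤
      ∫ x, f x * ProbabilityTheory.gaussianPDFReal 0 1 x := by
  set φ := ProbabilityTheory.gaussianPDFReal 0 1 with hφ
  have hφpos : ∀ x, 0 < φ x := fun x => ProbabilityTheory.gaussianPDFReal_pos 0 1 x one_ne_zero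
  have hφint : Integrable φ := ProbabilityTheory.integrable_gaussianPDFReal 0 1
  have hφ1 : ∫ x, φ x = 1 := ProbabilityTheory.integral_gaussianPDFReal_eq_one 0 one_ne_zero
  have hφd : ∀ x, HasDerivAt φ (-x * φ x) x := hasDerivAt_gaussianPDFReal
  have hφe : ∀ x, φ (-x) = φ x := fun x => by simp [hφ, gaussianPDFReal_zero_one]
  set w : ℝ → ℝ := fun x => Real.exp (a x) * φ x with hw
  have hwc : Continuous w := (Real.continuous_exp.comp ha).mul continuous_gaussianPDFReal
  have hwpos : ∀ x, 0 < w x := fun x => mul_pos (Real.exp_pos _) (hφpos x)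
  obtain ⟨Φ, hΦ, hΦ0, hΦ1⟩ := exists_primitive_gaussianPDFReal
  obtain ⟨T, hTM, hTd⟩ := exists_transport hwc hwpos hΦ hΦ0 hΦ1 hM
  set m := ∫ x in (-M)..M, w x with hm
  have hmpos : 0 < m := intervalIntegral.intervalIntegral_pos_of_pos
    (hwc.intervalIntegrable _ _) hwpos (by linarith)
  set T' : ℝ → ℝ := fun y => m * φ y / w (T y) with hT'
  have hT'pos : ∀ y, 0 < T' y := fun y => div_pos (mul_pos hmpos (hφpos y)) (hwpos _)
  have hlog : ∀ y, Real.log m ≤ f y + y ^ 2 - y * T y + T' y - 1 := fun y => by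
    have h1 : m = T' y * Real.exp (a (T y)) * (φ (T y) / φ y) := by
      have := (hφpos y).ne'
      have := (hφpos (T y)).ne'
      have := (Real.exp_pos (a (T y))).ne'
      simp only [hT', hw]
      field_simp
    have h2 : φ (T y) / φ y = Real.exp (y ^ 2 / 2 - T y ^ 2 / 2) := by
      have : (√(2 * π))⁻¹ ≠ 0 := by positivity
      simp only [hφ, gaussianPDFReal_zero_one]
      rw [mul_div_mul_left _ _ this, ← Real.exp_sub]
      congr 1
      ring
    have h3 : Real.log m = Real.log (T' y) + a (T y) + (y ^ 2 / 2 - T y ^ 2 / 2) := by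
      rw [h1, h2, Real.log_mul (mul_pos (hT'pos y) (Real.exp_pos _)).ne' (Real.exp_pos _).ne',
        Real.log_mul (hT'pos y).ne' (Real.exp_pos _).ne', Real.log_exp, Real.log_exp]
    have h4 := Real.log_le_sub_one_of_pos (hT'pos y)
    nlinarith [haf (T y) y]
  have hgd : ∀ y, HasDerivAt (fun y => (T y - y) * φ y)
      ((T' y - 1) * φ y + (T y - y) * (-y * φ y)) y := fun y =>
    ((hTd y).sub (hasDerivAt_id y)).mul (hφd y)
  have hsub : Integrable fun y => Real.log m * φ y - f y * φ y := (hφint.const_mul _).sub hf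
  have hR : ∀ R : ℝ, 0 ≤ R → ∫ y in (-R)..R, (Real.log m * φ y - f y * φ y) ≤
      2 * ((M + R) * φ R) := fun R hR => by
    have h := intervalIntegral.integral_le_sub_of_hasDeriv_right_of_le (a := -R) (b := R)
      (by linarith)
      (continuous_iff_continuousAt.2 fun x => (hgd x).continuousAt).continuousOn
      (fun x _ => (hgd x).hasDerivWithinAt) hsub.integrableOn
      (fun y _ => by nlinarith [mul_le_mul_of_nonneg_right (hlog y) (hφpos y).le])
    refine h.trans ?_
    rw [hφe]
    nlinarith [mul_le_mul_of_nonneg_right (abs_le.1 (hTM R)).2 (hφpos R).le,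
      mul_le_mul_of_nonneg_right (abs_le.1 (hTM (-R))).1 (hφpos R).le, mul_nonneg hR (hφpos R).le]
  have hlim := intervalIntegral_tendsto_integral hsub Filter.tendsto_neg_atTop_atBot
    Filter.tendsto_id
  have := le_of_tendsto_of_tendsto hlim (tendsto_const_add_abs_mul_gaussianPDFReal M)
    ((Filter.eventually_ge_atTop 0).mono hR)
  rw [integral_sub (hφint.const_mul _) hf, integral_const_mul, hφ1] at this
  linarith

/-- Infimal convolution inequality for the one-dimensional Gaussian. -/
lemma lintegral_gaussianReal_le_of_le_add_sq {f : ℝ → ℝ} {L : ℝ}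
    (hf : ∀ x y, f x ≤ f y + L * |x - y|) (hfi : Integrable f (ProbabilityTheory.gaussianReal 0 1))
    {A : ℝ → ℝ≥0∞} (hA : ∀ x y, A x ≤ ENNReal.ofReal (Real.exp (f y + (x - y) ^ 2 / 2))) :
    ∫⁻ x, A x ∂(ProbabilityTheory.gaussianReal 0 1) ≤
      ENNReal.ofReal (Real.exp (∫ x, f x ∂(ProbabilityTheory.gaussianReal 0 1))) := by
  set a : ℝ → ℝ := fun x => ⨅ z, f (x + z) + z ^ 2 / 2 with ha
  have hbdd : ∀ x, BddBelow (Set.range fun z => f (x + z) + z ^ 2 / 2) := fun x => by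
    refine ⟨f x - L ^ 2 / 2, ?_⟩
    rintro _ ⟨z, rfl⟩
    have := hf x (x + z)
    simp only [sub_add_cancel_left, abs_neg] at this
    nlinarith [sq_nonneg (|z| - L), sq_abs z]
  have haf : ∀ x y, a x ≤ f y + (x - y) ^ 2 / 2 := fun x y => by
    have := ciInf_le (hbdd x) (y - x)
    simp only [add_sub_cancel] at this
    calc a x ≤ _ := this
      _ = _ := by ring
  have hac : Continuous a := by
    refine (LipschitzWith.of_le_add_mul' (f := a) L fun x y => ?_).continuous
    rw [← sub_le_iff_le_add]
    refine le_ciInf fun z => ?_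
    have h1 := ciInf_le (hbdd x) z
    have h2 := hf (x + z) (y + z)
    rw [add_sub_add_right_eq_sub] at h2
    rw [Real.dist_eq]
    simp only [ha]
    linarith
  have hAa : ∀ x, A x ≤ ENNReal.ofReal (Real.exp (a x)) := fun x => by
    by_cases hx : A x = ⊤
    · exact absurd (hA x x) (by simp [hx])
    rcases eq_or_ne (A x) 0 with h0 | h0
    · simp [h0]
    have hpos : 0 < (A x).toReal := ENNReal.toReal_pos h0 hx
    rw [← ENNReal.ofReal_toReal hx]
    refine ENNReal.ofReal_le_ofReal ?_
    rw [← Real.log_le_iff_le_exp hpos]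
    refine le_ciInf fun z => ?_
    rw [Real.log_le_iff_le_exp hpos]
    refine ENNReal.toReal_le_of_le_ofReal (Real.exp_pos _).le ?_
    convert hA x (x + z) using 5
    ring
  set φ := ProbabilityTheory.gaussianPDFReal 0 1 with hφ
  have hφpos : ∀ x, 0 < φ x := fun x => ProbabilityTheory.gaussianPDFReal_pos 0 1 x one_ne_zero
  have hφc : Continuous φ := continuous_gaussianPDFReal
  have hγ : ProbabilityTheory.gaussianReal 0 1 =
      volume.withDensity fun x => ENNReal.ofReal (φ x) :=
    ProbabilityTheory.gaussianReal_of_var_ne_zero 0 one_ne_zero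
  have hfφ : Integrable fun x => f x * φ x := by
    rw [hγ, integrable_withDensity_iff (by fun_prop) (by simp)] at hfi
    simpa [ENNReal.toReal_ofReal (hφpos _).le] using hfi
  have hI : ∫ x, f x ∂(ProbabilityTheory.gaussianReal 0 1) = ∫ x, f x * φ x := by
    rw [ProbabilityTheory.integral_gaussianReal_eq_integral_smul one_ne_zero]
    simp [mul_comm, hφ]
  have hwc : Continuous fun x => Real.exp (a x) * φ x := (Real.continuous_exp.comp hac).mul hφc
  calc ∫⁻ x, A x ∂(ProbabilityTheory.gaussianReal 0 1)
      ≤ ∫⁻ x, ENNReal.ofReal (Real.exp (a x)) ∂(ProbabilityTheory.gaussianReal 0 1) :=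
        lintegral_mono hAa
    _ = ∫⁻ x, ENNReal.ofReal (Real.exp (a x) * φ x) := by
        rw [hγ, lintegral_withDensity_eq_lintegral_mul _ (by fun_prop) (by fun_prop)]
        refine lintegral_congr fun x => ?_
        rw [Pi.mul_apply, ← ENNReal.ofReal_mul (hφpos x).le, mul_comm]
    _ ≤ _ := by
        have hcov := (aecover_Icc (μ := (volume : Measure ℝ)) Filter.tendsto_neg_atTop_atBot
          Filter.tendsto_id).lintegral_tendsto_of_countably_generated
            hwc.measurable.ennreal_ofReal.aemeasurable
        refine le_of_tendsto hcov ((Filter.eventually_gt_atTop 0).mono fun M hM => ?_)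
        have hM' : -M ≤ M := by linarith
        rw [id, ← ofReal_integral_eq_lintegral_ofReal hwc.integrableOn_Icc
          (Filter.Eventually.of_forall fun x => (mul_pos (Real.exp_pos _) (hφpos x)).le),
          integral_Icc_eq_integral_Ioc, ← intervalIntegral.integral_of_le hM', hI]
        refine ENNReal.ofReal_le_ofReal ?_
        rw [← Real.log_le_iff_le_exp (intervalIntegral.intervalIntegral_pos_of_pos
          (hwc.intervalIntegrable _ _) (fun x => mul_pos (Real.exp_pos _) (hφpos x)) (by linarith))]
        exact log_integral_exp_le_of_le_add_sq hac hfφ haf hM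

lemma continuous_of_le_add_sum_abs {n : ℕ} {f : (Fin n → ℝ) → ℝ} {L : ℝ} (hL : 0 ≤ L)
    (hf : ∀ x y, f x ≤ f y + L * ∑ i, |x i - y i|) : Continuous f := by
  refine (LipschitzWith.of_le_add_mul' (f := f) (L * n) fun x y => (hf x y).trans ?_).continuous
  have : ∑ i, |x i - y i| ≤ ∑ _i : Fin n, dist x y :=
    Finset.sum_le_sum fun i _ => by
      rw [← Real.dist_eq]; exact dist_le_pi_dist x y i
  rw [Finset.sum_const, Finset.card_univ, Fintype.card_fin, nsmul_eq_mul] at this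
  nlinarith [mul_le_mul_of_nonneg_left this hL]

lemma integrable_pi_gaussianReal_of_le_add_sum_abs {n : ℕ} {f : (Fin n → ℝ) → ℝ} {L : ℝ}
    (hL : 0 ≤ L) (hf : ∀ x y, f x ≤ f y + L * ∑ i, |x i - y i|) :
    Integrable f (Measure.pi fun _ => ProbabilityTheory.gaussianReal 0 1) := by
  have hid : Integrable (fun x : ℝ => x) (ProbabilityTheory.gaussianReal 0 1) :=
    ProbabilityTheory.IsGaussian.integrable_id
  have hcoord : ∀ i : Fin n, Integrable (fun x : Fin n → ℝ => |x i|)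
      (Measure.pi fun _ => ProbabilityTheory.gaussianReal 0 1) := fun i =>
    (integrable_comp_eval (μ := fun _ : Fin n => ProbabilityTheory.gaussianReal 0 1)
      (i := i) hid).abs
  have hg : Integrable (fun x : Fin n → ℝ => |f 0| + L * ∑ i, |x i|)
      (Measure.pi fun _ => ProbabilityTheory.gaussianReal 0 1) :=
    (integrable_const _).add ((integrable_finsetSum _ fun i _ => hcoord i).const_mul L)
  refine hg.mono' (continuous_of_le_add_sum_abs hL hf).aestronglyMeasurable
    (Filter.Eventually.of_forall fun x => ?_)
  have h1 := hf x 0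
  have h2 := hf 0 x
  simp only [Pi.zero_apply, sub_zero, zero_sub, abs_neg] at h1 h2
  rw [Real.norm_eq_abs, abs_le]
  constructor <;> linarith [le_abs_self (f 0), neg_abs_le (f 0)]

/-- Infimal convolution inequality for the standard Gaussian on `Fin n → ℝ`. -/
lemma lintegral_pi_gaussianReal_le_of_le_add_sq {L : ℝ} (hL : 0 ≤ L) :
    ∀ (n : ℕ) {f : (Fin n → ℝ) → ℝ} {A : (Fin n → ℝ) → ℝ≥0∞},
    (∀ x y, f x ≤ f y + L * ∑ i, |x i - y i|) → Measurable A →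
    (∀ x y, A x ≤ ENNReal.ofReal (Real.exp (f y + (∑ i, (x i - y i) ^ 2) / 2))) →
    ∫⁻ x, A x ∂(Measure.pi fun _ => ProbabilityTheory.gaussianReal 0 1) ≤
      ENNReal.ofReal
        (Real.exp (∫ x, f x ∂(Measure.pi fun _ => ProbabilityTheory.gaussianReal 0 1)))
  | 0, f, A, hf, hA, hAf => by
    rw [Measure.pi_of_empty _ 0, lintegral_dirac, integral_dirac]
    simpa using hAf 0 0
  | n + 1, f, A, hf, hA, hAf => by
    set γ := ProbabilityTheory.gaussianReal 0 1 with hγ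
    set γn : Measure (Fin n → ℝ) := Measure.pi fun _ => γ with hγn
    have hmp : MeasurePreserving (MeasurableEquiv.piFinSuccAbove (fun _ : Fin (n + 1) => ℝ) 0).symm
        (γ.prod γn) (Measure.pi fun _ => γ) :=
      (measurePreserving_piFinSuccAbove (fun _ : Fin (n + 1) => γ) 0).symm
    have hsymm : ∀ p : ℝ × (Fin n → ℝ),
        (MeasurableEquiv.piFinSuccAbove (fun _ : Fin (n + 1) => ℝ) 0).symm p =
          Fin.cons p.1 p.2 := fun p => by
      simp [MeasurableEquiv.piFinSuccAbove, Fin.insertNthEquiv]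
    have hcons : Measurable fun p : ℝ × (Fin n → ℝ) => (Fin.cons p.1 p.2 : Fin (n + 1) → ℝ) := by
      rw [← funext hsymm]; exact MeasurableEquiv.measurable _
    set F : ℝ → ℝ := fun y => ∫ z, f (Fin.cons y z) ∂γn with hF
    have hfs : ∀ y : ℝ, ∀ z z' : Fin n → ℝ, f (Fin.cons y z) ≤
        f (Fin.cons y z') + L * ∑ i, |z i - z' i| := fun y z z' => by
      simpa [Fin.sum_univ_succ] using hf (Fin.cons y z) (Fin.cons y z')
    have hfsi : ∀ y : ℝ, Integrable (fun z : Fin n → ℝ => f (Fin.cons y z)) γn := fun y =>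
      integrable_pi_gaussianReal_of_le_add_sum_abs hL (hfs y)
    have hFL : ∀ x y, F x ≤ F y + L * |x - y| := fun x y => by
      have : F y + L * |x - y| = ∫ z, (f (Fin.cons y z) + L * |x - y|) ∂γn := by
        rw [integral_add (hfsi y) (integrable_const _)]
        simp [hF]
      rw [this]
      refine integral_mono (hfsi x) ((hfsi y).add (integrable_const _)) fun z => ?_
      simpa [Fin.sum_univ_succ] using hf (Fin.cons x z) (Fin.cons y z)
    have hfi : Integrable (fun p : ℝ × (Fin n → ℝ) => f (Fin.cons p.1 p.2)) (γ.prod γn) := by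
      have := (hmp.integrable_comp_emb (MeasurableEquiv.measurableEmbedding _)).2
        (integrable_pi_gaussianReal_of_le_add_sum_abs hL hf)
      simpa only [Function.comp_def, hsymm] using this
    have hIF : ∫ x, f x ∂(Measure.pi fun _ => γ) = ∫ y, F y ∂γ := by
      rw [← hmp.integral_comp (MeasurableEquiv.measurableEmbedding _)]
      simp only [hsymm]
      rw [integral_prod _ hfi]
    have hIA : ∫⁻ x, A x ∂(Measure.pi fun _ => γ) =
        ∫⁻ x, ∫⁻ z, A (Fin.cons x z) ∂γn ∂γ := by
      rw [← hmp.lintegral_comp hA]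
      simp only [hsymm]
      exact lintegral_prod _ (hA.comp hcons).aemeasurable
    rw [hIF, hIA]
    refine lintegral_gaussianReal_le_of_le_add_sq hFL hfi.integral_prod_left fun x y => ?_
    set c : ℝ := (x - y) ^ 2 / 2 with hc
    have hmeas : Measurable fun z : Fin n → ℝ => A (Fin.cons x z) :=
      (hA.comp hcons).comp measurable_prodMk_left
    have hstep := lintegral_pi_gaussianReal_le_of_le_add_sq hL n
      (f := fun z => f (Fin.cons y z))
      (A := fun z => ENNReal.ofReal (Real.exp (-c)) * A (Fin.cons x z)) (hfs y)
      (hmeas.const_mul _) fun z z' => by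
        refine (mul_le_mul_right (hAf (Fin.cons x z) (Fin.cons y z')) _).trans ?_
        rw [← ENNReal.ofReal_mul (Real.exp_pos _).le, ← Real.exp_add]
        refine ENNReal.ofReal_le_ofReal (Real.exp_le_exp.2 (le_of_eq ?_))
        simp only [Fin.sum_univ_succ, Fin.cons_zero, Fin.cons_succ, hc]
        ring
    rw [lintegral_const_mul _ hmeas] at hstep
    calc ∫⁻ z, A (Fin.cons x z) ∂γn
        = ENNReal.ofReal (Real.exp c) *
          (ENNReal.ofReal (Real.exp (-c)) * ∫⁻ z, A (Fin.cons x z) ∂γn) := by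
          rw [← mul_assoc, ← ENNReal.ofReal_mul (Real.exp_pos _).le, ← Real.exp_add]
          simp
      _ ≤ ENNReal.ofReal (Real.exp c) * ENNReal.ofReal (Real.exp (F y)) := mul_le_mul_right hstep _
      _ = _ := by
          rw [← ENNReal.ofReal_mul (Real.exp_pos _).le, ← Real.exp_add, add_comm]

lemma pi_gaussianReal_eq_withDensity (n : ℕ) :
    (Measure.pi fun _ : Fin n => ProbabilityTheory.gaussianReal 0 1) =
      (volume : Measure (Fin n → ℝ)).withDensity fun x =>
        ENNReal.ofReal (∏ i, ProbabilityTheory.gaussianPDFReal 0 1 (x i)) := by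
  refine Measure.pi_eq fun s hs => ?_
  have hpos := ProbabilityTheory.gaussianPDFReal_nonneg 0 1
  have hint : ∀ i, Integrable (ProbabilityTheory.gaussianPDFReal 0 1)
      ((volume : Measure ℝ).restrict (s i)) := fun i =>
    (ProbabilityTheory.integrable_gaussianPDFReal 0 1).restrict
  rw [withDensity_apply _ (MeasurableSet.univ_pi hs), volume_pi, Measure.restrict_pi_pi,
    ← ofReal_integral_eq_lintegral_ofReal (Integrable.fintype_prod hint)
      (Filter.Eventually.of_forall fun x => Finset.prod_nonneg fun i _ => hpos _),
    integral_fintype_prod_eq_prod (f := fun _ => ProbabilityTheory.gaussianPDFReal 0 1),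
    ENNReal.ofReal_prod_of_nonneg fun i _ => integral_nonneg hpos]
  exact Finset.prod_congr rfl fun i _ =>
    (ProbabilityTheory.gaussianReal_apply_eq_integral 0 one_ne_zero _).symm

lemma measurePreserving_toLp_stdGaussian (n : ℕ) :
    MeasurePreserving (MeasurableEquiv.toLp 2 (Fin n → ℝ))
      (Measure.pi fun _ => ProbabilityTheory.gaussianReal 0 1) (stdGaussian n) := by
  refine ⟨MeasurableEquiv.measurable _, ?_⟩
  ext s hs
  have hdens : Measurable fun x : EuclideanSpace ℝ (Fin n) =>
      ENNReal.ofReal ((2 * π) ^ (-(n : ℝ) / 2) * Real.exp (-‖x‖ ^ 2 / 2)) := by fun_prop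
  rw [Measure.map_apply (MeasurableEquiv.measurable _) hs, pi_gaussianReal_eq_withDensity,
    withDensity_apply _ (MeasurableEquiv.measurable _ hs), stdGaussian, withDensity_apply _ hs]
  rw [← (PiLp.volume_preserving_toLp (Fin n)).setLIntegral_comp_preimage hs hdens]
  refine lintegral_congr fun x => ?_
  congr 1
  simp_rw [gaussianPDFReal_zero_one]
  rw [Finset.prod_mul_distrib, ← Real.exp_sum, Finset.prod_const, Finset.card_univ,
    Fintype.card_fin, EuclideanSpace.norm_sq_eq, ← Finset.sum_div]
  have hc : (√(2 * π))⁻¹ ^ n = (2 * π) ^ (-(n : ℝ) / 2) := by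
    rw [Real.sqrt_eq_rpow, ← Real.rpow_neg (by positivity), ← Real.rpow_natCast,
      ← Real.rpow_mul (by positivity)]
    congr 1
    ring
  rw [hc]
  simp

/-- Infimal convolution inequality for the standard Gaussian on Euclidean space. -/
lemma lintegral_stdGaussian_le_of_le_add_sq {n : ℕ} {L : ℝ} (hL : 0 ≤ L)
    {f : EuclideanSpace ℝ (Fin n) → ℝ} {A : EuclideanSpace ℝ (Fin n) → ℝ≥0∞}
    (hf : ∀ x y, f x ≤ f y + L * ∑ i, |x i - y i|) (hA : Measurable A)
    (hAf : ∀ x y, A x ≤ ENNReal.ofReal (Real.exp (f y + ‖x - y‖ ^ 2 / 2))) :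
    ∫⁻ x, A x ∂(stdGaussian n) ≤ ENNReal.ofReal (Real.exp (∫ x, f x ∂(stdGaussian n))) := by
  have hmp := measurePreserving_toLp_stdGaussian n
  rw [← hmp.lintegral_comp hA, ← hmp.integral_comp (MeasurableEquiv.measurableEmbedding _)]
  refine lintegral_pi_gaussianReal_le_of_le_add_sq hL n (fun x y => hf _ _)
    (hA.comp hmp.measurable) fun x y => (hAf _ (WithLp.toLp 2 y)).trans (le_of_eq ?_)
  rw [EuclideanSpace.norm_sq_eq]
  simp

instance isProbabilityMeasure_stdGaussian (n : ℕ) : IsProbabilityMeasure (stdGaussian n) :=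
  (measurePreserving_toLp_stdGaussian n).map_eq ▸ Measure.isProbabilityMeasure_map
    (measurePreserving_toLp_stdGaussian n).measurable.aemeasurable

/-- One half of the Gibbs variational principle. -/
lemma integral_le_integral_llr_add_log_integral_exp {α : Type*} {mα : MeasurableSpace α}
    {μ ν : Measure α} [IsProbabilityMeasure μ] [IsProbabilityMeasure ν] {f : α → ℝ} (hμν : μ ≪ ν)
    (hllr : Integrable (llr μ ν) μ) (hf : Integrable f μ)
    (hexp : Integrable (fun x => Real.exp (f x)) ν) :
    ∫ x, f x ∂μ ≤ ∫ x, llr μ ν x ∂μ + Real.log (∫ x, Real.exp (f x) ∂ν) := by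
  have := isProbabilityMeasure_tilted hexp
  have h := InformationTheory.integral_llr_add_sub_measure_univ_nonneg
    (hμν.trans (absolutelyContinuous_tilted hexp)) (integrable_llr_tilted_right hμν hf hllr hexp)
  rw [integral_llr_tilted_right hμν hf hexp hllr] at h
  simp only [probReal_univ] at h
  linarith

lemma exists_coord_bound_of_bddAbove_inner {n : ℕ} {K : Set (EuclideanSpace ℝ (Fin n))}
    (hbdd : ∀ x : EuclideanSpace ℝ (Fin n),
      BddAbove (Set.range fun t : K => ⟪x, (t : EuclideanSpace ℝ (Fin n))⟫)) :
    ∃ L : ℝ, 0 ≤ L ∧ ∀ t ∈ K, ∀ i, |t i| ≤ L := by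
  choose B hB using hbdd
  set C : Fin n → ℝ := fun i =>
    |B (EuclideanSpace.single i 1)| + |B (-EuclideanSpace.single i 1)| with hC
  refine ⟨∑ i, C i, Finset.sum_nonneg fun i _ => by positivity, fun t ht i => ?_⟩
  have h1 := hB (EuclideanSpace.single i 1) ⟨⟨t, ht⟩, rfl⟩
  have h2 := hB (-EuclideanSpace.single i 1) ⟨⟨t, ht⟩, rfl⟩
  simp only [inner_neg_left, EuclideanSpace.inner_single_left, map_one, one_mul] at h1 h2
  have h3 : C i ≤ ∑ i, C i :=
    Finset.single_le_sum (fun i _ => by positivity) (Finset.mem_univ i)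
  refine le_trans (abs_le.2 ⟨?_, ?_⟩) h3
  · linarith [le_abs_self (B (-EuclideanSpace.single i 1)),
      abs_nonneg (B (EuclideanSpace.single i 1))]
  · linarith [le_abs_self (B (EuclideanSpace.single i 1)),
      abs_nonneg (B (-EuclideanSpace.single i 1))]

lemma inner_le_gaussWidthFn_of_mem_closure {n : ℕ} {K : Set (EuclideanSpace ℝ (Fin n))}
    {y t : EuclideanSpace ℝ (Fin n)}
    (hbdd : BddAbove (Set.range fun t : K => ⟪y, (t : EuclideanSpace ℝ (Fin n))⟫))
    (ht : t ∈ closure K) : ⟪y, t⟫ ≤ gaussWidthFn K y :=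
  closure_minimal (t := {t | ⟪y, t⟫ ≤ gaussWidthFn K y}) (fun s hs => le_ciSup hbdd ⟨s, hs⟩)
    (isClosed_le (by fun_prop) continuous_const) ht

lemma gaussWidthFn_le_add_sum_abs {n : ℕ} {K : Set (EuclideanSpace ℝ (Fin n))} (hK : K.Nonempty)
    (hbdd : ∀ x : EuclideanSpace ℝ (Fin n),
      BddAbove (Set.range fun t : K => ⟪x, (t : EuclideanSpace ℝ (Fin n))⟫))
    {L : ℝ} (hL : ∀ t ∈ K, ∀ i, |t i| ≤ L) (x y : EuclideanSpace ℝ (Fin n)) :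
    gaussWidthFn K x ≤ gaussWidthFn K y + L * ∑ i, |x i - y i| := by
  have := hK.to_subtype
  refine ciSup_le fun t => ?_
  have h1 : ⟪y, (t : EuclideanSpace ℝ (Fin n))⟫ ≤ gaussWidthFn K y := le_ciSup (hbdd y) t
  have h2 : ⟪x - y, (t : EuclideanSpace ℝ (Fin n))⟫ ≤ L * ∑ i, |x i - y i| := by
    rw [PiLp.inner_apply, Finset.mul_sum]
    refine Finset.sum_le_sum fun i _ => (le_abs_self _).trans ?_
    simp only [RCLike.inner_apply, conj_trivial, PiLp.sub_apply, abs_mul]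
    exact mul_le_mul_of_nonneg_right (hL t t.2 i) (abs_nonneg _)
  rw [inner_sub_left] at h2
  linarith

theorem combined_gibbs_bound (n : ℕ) (K : Set (EuclideanSpace ℝ (Fin n)))
    (hKne : K.Nonempty)
    (hbdd : ∀ x : EuclideanSpace ℝ (Fin n),
      BddAbove (Set.range fun t : K => ⟪x, (t : EuclideanSpace ℝ (Fin n))⟫))
    (hbddZ : ∀ x : EuclideanSpace ℝ (Fin n),
      BddAbove (Set.range fun t : K =>
        ⟪x, (t : EuclideanSpace ℝ (Fin n))⟫ - ‖(t : EuclideanSpace ℝ (Fin n))‖ ^ 2 / 2))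
    (hint : Integrable (gaussWidthFn K) (stdGaussian n))
    (ν : Measure (EuclideanSpace ℝ (Fin n))) (hν : IsProbabilityMeasure ν)
    (hac : ν ≪ stdGaussian n)
    (hKL : Integrable
      (fun x => Real.log ((ν.rnDeriv (stdGaussian n) x).toReal)) ν)
    (g : EuclideanSpace ℝ (Fin n) → EuclideanSpace ℝ (Fin n))
    (hg : Measurable g) (hgK : ∀ x, g x ∈ closure K)
    (hgint : Integrable (fun x => ⟪x, g x⟫ - ‖g x‖ ^ 2 / 2) ν) :
    ∫ x, (⟪x, g x⟫ - ‖g x‖ ^ 2 / 2) ∂ν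
      ≤ ∫ x, Real.log ((ν.rnDeriv (stdGaussian n) x).toReal) ∂ν
        + ∫ x, gaussWidthFn K x ∂(stdGaussian n) := by
  obtain ⟨L, hL0, hL⟩ := exists_coord_bound_of_bddAbove_inner hbdd
  set b : EuclideanSpace ℝ (Fin n) → ℝ := fun x => ⟪x, g x⟫ - ‖g x‖ ^ 2 / 2 with hb
  have hbm : Measurable b := by fun_prop
  have hbh : ∀ x y, b x ≤ gaussWidthFn K y + ‖x - y‖ ^ 2 / 2 := fun x y => by
    have h1 := inner_le_gaussWidthFn_of_mem_closure (hbdd y) (hgK x)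
    have h2 := real_inner_le_norm (x - y) (g x)
    rw [inner_sub_left] at h2
    simp only [hb]
    nlinarith [sq_nonneg (‖x - y‖ - ‖g x‖)]
  have hle := lintegral_stdGaussian_le_of_le_add_sq hL0
    (gaussWidthFn_le_add_sum_abs hKne hbdd hL) hbm.exp.ennreal_ofReal
    fun x y => ENNReal.ofReal_le_ofReal (Real.exp_le_exp.2 (hbh x y))
  have hexp : Integrable (fun x => Real.exp (b x)) (stdGaussian n) :=
    (lintegral_ofReal_ne_top_iff_integrable hbm.exp.aestronglyMeasurable
      (Filter.Eventually.of_forall fun x => (Real.exp_pos _).le)).1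
      (hle.trans_lt ENNReal.ofReal_lt_top).ne
  rw [← ofReal_integral_eq_lintegral_ofReal hexp
    (Filter.Eventually.of_forall fun x => (Real.exp_pos _).le),
    ENNReal.ofReal_le_ofReal_iff (Real.exp_pos _).le,
    ← Real.log_le_iff_le_exp (integral_exp_pos hexp)] at hle
  exact (integral_le_integral_llr_add_log_integral_exp hac hKL hgint hexp).trans (by gcongr; rfl)
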